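/- arXiv:0810.5204 — 6 statements merged into one kernel-verified Lean document; each statement's English description precedes it below -/
import Mathlib

section
/- There exist absolute constants θ > 0 and σ > 0 with the following property: for every finite set Γ of cardinality Q and every integer D with 1 ≤ D ≤ Q, there exists a family 𝓜_D of subsets of Γ such that (i) log(card 𝓜_D) ≥ σ D if D = Q, and log(card 𝓜_D) ≥ σ D log(Q/D) if D < Q, and (ii) for every two distinct members m, m' of 𝓜_D, the cardinality of the symmetric difference m Δ m' is at least θ D. -/
/-- Exponentially few subsets of a finite set contain less than an eighth of its elements. -/
theorem card_filter_eight_mul_card_lt_le {α : Type*} (Γ : Finset α) :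
    ((Γ.powerset.filter fun s => 8 * s.card < Γ.card).card : ℝ) ≤ (3 / 2) ^ Γ.card := by
  calc ((Γ.powerset.filter fun s => 8 * s.card < Γ.card).card : ℝ)
      = ∑ s ∈ Γ.powerset.filter fun s => 8 * s.card < Γ.card, (1 : ℝ) := by simp
    _ ≤ ∑ s ∈ Γ.powerset.filter fun s => 8 * s.card < Γ.card,
          (1 / 4 : ℝ) ^ s.card * (6 / 5) ^ Γ.card := by
        refine Finset.sum_le_sum fun s hs => ?_
        have hlt := (Finset.mem_filter.1 hs).2
        calc (1 : ℝ) = (1 / 4) ^ s.card * 4 ^ s.card := by rw [← mul_pow]; norm_num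
          _ ≤ (1 / 4) ^ s.card * ((6 / 5) ^ 8) ^ s.card := by gcongr; norm_num
          _ = (1 / 4) ^ s.card * (6 / 5) ^ (8 * s.card) := by rw [← pow_mul]
          _ ≤ (1 / 4) ^ s.card * (6 / 5) ^ Γ.card := by gcongr; norm_num
    _ ≤ ∑ s ∈ Γ.powerset, (1 / 4 : ℝ) ^ s.card * (6 / 5) ^ Γ.card :=
        Finset.sum_le_sum_of_subset_of_nonneg (Finset.filter_subset _ _)
          fun _ _ _ => by positivity
    _ = (1 / 4 + 1) ^ Γ.card * (6 / 5) ^ Γ.card := by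
        rw [← Finset.sum_mul, ← Finset.sum_pow_mul_eq_add_pow]
        simp
    _ = (3 / 2) ^ Γ.card := by rw [← mul_pow]; norm_num

/-- A Gilbert–Varshamov bound: a nonempty finite set has exponentially many subsets that
pairwise differ in at least one eighth of the elements. -/
theorem exists_large_separated_family {α : Type*} [DecidableEq α] {Γ : Finset α}
    (hΓ : Γ.Nonempty) :
    ∃ 𝓜 : Finset (Finset α), (∀ m ∈ 𝓜, m ⊆ Γ) ∧ (4 / 3 : ℝ) ^ Γ.card ≤ 𝓜.card ∧
      ∀ m ∈ 𝓜, ∀ m' ∈ 𝓜, m ≠ m' → Γ.card ≤ 8 * (symmDiff m m').card := by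
  let separated := Γ.powerset.powerset.filter fun 𝓜 =>
    ∀ m ∈ 𝓜, ∀ m' ∈ 𝓜, m ≠ m' → Γ.card ≤ 8 * (symmDiff m m').card
  obtain ⟨𝓜, h𝓜, hmax⟩ := separated.exists_max_image Finset.card ⟨∅, by simp [separated]⟩
  obtain ⟨hsub, hsep⟩ := Finset.mem_filter.1 h𝓜
  rw [Finset.mem_powerset] at hsub
  refine ⟨𝓜, fun m hm => Finset.mem_powerset.1 (hsub hm), ?_, hsep⟩
  let small := Γ.powerset.filter fun s => 8 * s.card < Γ.card
  have hcover : Γ.powerset ⊆ 𝓜.biUnion fun m => small.image (symmDiff m) := by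
    intro s hs
    have hnear : s ∈ 𝓜 ∨ ∃ m ∈ 𝓜, 8 * (symmDiff m s).card < Γ.card := by
      by_contra! hfar
      have hinsert : insert s 𝓜 ∈ separated := by
        refine Finset.mem_filter.2
          ⟨Finset.mem_powerset.2 (Finset.insert_subset hs hsub), fun m hm m' hm' hne => ?_⟩
        rcases Finset.mem_insert.1 hm with rfl | hmem <;>
          rcases Finset.mem_insert.1 hm' with rfl | hmem'
        · exact absurd rfl hne
        · rw [symmDiff_comm]
          exact hfar.2 m' hmem'
        · exact hfar.2 m hmem
        · exact hsep m hmem m' hmem' hne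
      have := hmax _ hinsert
      rw [Finset.card_insert_of_notMem hfar.1] at this
      omega
    rw [Finset.mem_biUnion]
    obtain ⟨m, hm, hlt⟩ : ∃ m ∈ 𝓜, 8 * (symmDiff m s).card < Γ.card := by
      rcases hnear with hs𝓜 | h
      · exact ⟨s, hs𝓜, by simpa using hΓ.card_pos⟩
      · exact h
    refine ⟨m, hm, Finset.mem_image.2
      ⟨symmDiff m s, Finset.mem_filter.2 ⟨?_, hlt⟩, symmDiff_symmDiff_cancel_left m s⟩⟩
    rw [Finset.mem_powerset] at hs ⊢
    exact symmDiff_le_sup.trans (sup_le (Finset.mem_powerset.1 (hsub hm)) hs)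
  have hcard : 2 ^ Γ.card ≤ 𝓜.card * small.card := by
    rw [← Finset.card_powerset]
    exact (Finset.card_le_card hcover).trans
      (Finset.card_biUnion_le_card_mul _ _ _ fun _ _ => Finset.card_image_le)
  have hpow : (4 / 3 : ℝ) ^ Γ.card * (3 / 2) ^ Γ.card ≤ 𝓜.card * (3 / 2) ^ Γ.card :=
    calc (4 / 3 : ℝ) ^ Γ.card * (3 / 2) ^ Γ.card = 2 ^ Γ.card := by rw [← mul_pow]; norm_num
      _ ≤ 𝓜.card * small.card := by exact_mod_cast hcard
      _ ≤ 𝓜.card * (3 / 2) ^ Γ.card := by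
        gcongr
        exact card_filter_eight_mul_card_lt_le Γ
  exact le_of_mul_le_mul_right hpow (by positivity)


/-- Gallager's combinatorial lemma (Lemma 7 of the paper): there exist absolute constants
`θ, σ > 0` such that for every finite set `Γ` of cardinality `Q` and every `1 ≤ D ≤ Q`
there is a family `𝓜` of subsets of `Γ` with `log |𝓜| ≥ σ D` if `D = Q`,
`log |𝓜| ≥ σ D log (Q / D)` if `D < Q`, and such that any two distinct members of `𝓜`
have symmetric difference of cardinality at least `θ D`. -/
theorem gallager_lemma : ∃ θ : ℝ, 0 < θ ∧ ∃ σ : ℝ, 0 < σ ∧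
    ∀ (α : Type*) [DecidableEq α] (Γ : Finset α) (D : ℕ),
      1 ≤ D → D ≤ Γ.card →
      ∃ 𝓜 : Finset (Finset α),
        (∀ m ∈ 𝓜, m ⊆ Γ) ∧
        (D = Γ.card → σ * D ≤ Real.log 𝓜.card) ∧
        (D < Γ.card → σ * D * Real.log ((Γ.card : ℝ) / D) ≤ Real.log 𝓜.card) ∧
        ∀ m ∈ 𝓜, ∀ m' ∈ 𝓜, m ≠ m' → θ * D ≤ ((symmDiff m m').card : ℝ) := by
  have hσ : 0 < Real.log (4 / 3) := Real.log_pos (by norm_num)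
  refine ⟨1 / 8, by norm_num, Real.log (4 / 3), hσ, fun α _ Γ D hD hDΓ => ?_⟩
  obtain ⟨𝓜, hsub, hcard, hsep⟩ :=
    exists_large_separated_family (Finset.card_pos.1 (hD.trans hDΓ))
  have hlog : Real.log (4 / 3) * Γ.card ≤ Real.log 𝓜.card := by
    rw [mul_comm, ← Real.log_pow]
    exact Real.log_le_log (by positivity) hcard
  have hDpos : (0 : ℝ) < D := by exact_mod_cast hD
  have hΓpos : (0 : ℝ) < Γ.card := hDpos.trans_le (by exact_mod_cast hDΓ)
  refine ⟨𝓜, hsub, fun h => by rwa [h], fun _ => ?_, fun m hm m' hm' hne => ?_⟩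
  · have hle : D * Real.log ((Γ.card : ℝ) / D) ≤ Γ.card :=
      calc D * Real.log ((Γ.card : ℝ) / D) ≤ D * (Γ.card / D) := by
            gcongr
            exact Real.log_le_self (by positivity)
        _ = Γ.card := by field_simp
    rw [mul_assoc]
    exact (mul_le_mul_of_nonneg_left hle hσ.le).trans hlog
  · have h : (D : ℝ) ≤ 8 * (symmDiff m m').card := by
      exact_mod_cast hDΓ.trans (hsep m hm m' hm' hne)
    linarith
end

section
/- There exists an absolute constant θ' with 0 < θ' < 1 (θ' = 0.01 works) such that the following holds: for every real γ ≥ 1, setting C' = (√6 + 1/3)γ, for every integer n ≥ 2 with (1 − θ')(√6 + 1/3) log n ≥ 2 and every real m ≥ 0 with m ≤ θ' C' log n, if N is a Poisson random variable with mean m, then P(N − m ≥ (1 − θ') C' log n) ≤ m · n^{−γ−1}. -/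
open MeasureTheory

/-- A Chernoff-type bound for the upper tail of a Poisson distribution of mean `m`, carrying an
extra factor `m`. -/
theorem poisson_measure_ge_le {m s t : ℝ} (hm : 0 ≤ m) (hs : 0 ≤ s) (ht : 1 ≤ t)
    {μ : Measure ℕ}
    (hμ : ∀ k : ℕ, μ {k} = ENNReal.ofReal (Real.exp (-m) * m ^ k / k.factorial)) :
    μ {k : ℕ | t ≤ (k : ℝ)}
      ≤ ENNReal.ofReal (m * Real.exp (m * (Real.exp s - 1) - s * (t - 1))) := by
  set S : Set ℕ := {k : ℕ | t ≤ (k : ℝ)} with hS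
  let c : ℝ := m * Real.exp (-m - s * (t - 1))
  have hsum : HasSum (fun j : ℕ => c * ((m * Real.exp s) ^ j / j.factorial))
      (m * Real.exp (m * (Real.exp s - 1) - s * (t - 1))) := by
    have h := NormedSpace.expSeries_div_hasSum_exp (m * Real.exp s)
    rw [← Real.exp_eq_exp_ℝ] at h
    have hc : c * Real.exp (m * Real.exp s)
        = m * Real.exp (m * (Real.exp s - 1) - s * (t - 1)) := by
      rw [mul_assoc, ← Real.exp_add]
      ring_nf
    exact hc ▸ h.mul_left c
  rw [← Measure.tsum_indicator_apply_singleton μ S (Set.to_countable S).measurableSet,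
    tsum_eq_zero_add' ENNReal.summable, ← hsum.tsum_eq,
    ENNReal.ofReal_tsum_of_nonneg (fun j => by positivity) hsum.summable]
  have h0 : S.indicator (fun k => μ {k}) 0 = 0 :=
    Set.indicator_of_notMem (by simp only [hS, Set.mem_ofPred_eq, Nat.cast_zero]; linarith) _
  rw [h0, zero_add]
  refine ENNReal.tsum_le_tsum fun j => ?_
  refine Set.indicator_apply_le' (fun hj => ?_) fun _ => zero_le
  rw [hμ]
  apply ENNReal.ofReal_le_ofReal
  have hj' : t ≤ (j : ℝ) + 1 := by simpa [hS] using hj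
  have hfac : (1 : ℝ) ≤ (j : ℝ) + 1 := by linarith
  calc Real.exp (-m) * m ^ (j + 1) / ((j + 1).factorial : ℝ)
      = m * (m ^ j / j.factorial) * Real.exp (-m) / ((j : ℝ) + 1) := by
        rw [Nat.factorial_succ]
        push_cast
        field_simp
        ring
    _ ≤ m * (m ^ j / j.factorial) * Real.exp (-m) := div_le_self (by positivity) hfac
    _ ≤ m * (m ^ j / j.factorial) * Real.exp (-m - s * (t - 1) + j * s) := by
        gcongr
        nlinarith
    _ = c * ((m * Real.exp s) ^ j / j.factorial) := by
        rw [Real.exp_add, Real.exp_nat_mul, mul_pow]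
        ring

/-- Lemma 3 of the paper in terms of a single Poisson count: there is an absolute constant
`θ' ∈ (0,1)` (θ' = 0.01 works) such that for every `γ ≥ 1`, with `C' = (√6 + 1/3)γ`,
for every `n ≥ 2` with `(1-θ')(√6 + 1/3) log n ≥ 2` and every mean `0 ≤ m ≤ θ' C' log n`,
a Poisson random variable `N` with mean `m` satisfies
`P(N - m ≥ (1-θ') C' log n) ≤ m n^{-γ-1}`. -/
theorem poisson_tail_lemma : ∃ θ' : ℝ, 0 < θ' ∧ θ' < 1 ∧
    ∀ γ : ℝ, 1 ≤ γ → ∀ n : ℕ, 2 ≤ n →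
      2 ≤ (1 - θ') * (Real.sqrt 6 + 1 / 3) * Real.log n →
      ∀ m : ℝ, 0 ≤ m → m ≤ θ' * ((Real.sqrt 6 + 1 / 3) * γ) * Real.log n →
      ∀ μ : Measure ℕ,
        (∀ k : ℕ, μ {k} = ENNReal.ofReal (Real.exp (-m) * m ^ k / k.factorial)) →
        μ {k : ℕ | (1 - θ') * ((Real.sqrt 6 + 1 / 3) * γ) * Real.log n ≤ (k : ℝ) - m}
          ≤ ENNReal.ofReal (m * (n : ℝ) ^ (-γ - 1)) := by
  refine ⟨1 / 100, by norm_num, by norm_num, ?_⟩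
  intro γ hγ n hn hL m hm hmL μ hμ
  set a : ℝ := Real.sqrt 6 + 1 / 3
  set L : ℝ := Real.log n
  set T : ℝ := (1 - 1 / 100) * (a * γ) * L with hT
  have hn0 : (0 : ℝ) < n := by exact_mod_cast (by lia : 0 < n)
  have hL0 : 0 ≤ L := Real.log_natCast_nonneg n
  have ha : 2.7 ≤ a := by
    have : (2.4 : ℝ) ≤ Real.sqrt 6 := Real.le_sqrt_of_sq_le (by norm_num)
    simp only [a]
    linarith
  have hT2 : 2 ≤ T := by
    have : T = ((1 - 1 / 100) * a * L) * γ := by rw [hT]; ring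
    nlinarith
  have he : Real.exp 2 ≤ 8 := by
    have h1 := Real.exp_one_lt_d9
    have h2 : Real.exp 2 = Real.exp 1 * Real.exp 1 := by rw [← Real.exp_add]; norm_num
    nlinarith [Real.exp_pos 1]
  have hLγ : L ≤ γ * L := by nlinarith
  have haγ : 2.7 * (γ * L) ≤ a * (γ * L) := by gcongr
  calc μ {k : ℕ | T ≤ (k : ℝ) - m}
      ≤ μ {k : ℕ | T ≤ (k : ℝ)} :=
        measure_mono fun k (hk : T ≤ (k : ℝ) - m) => show T ≤ (k : ℝ) by linarith
    _ ≤ ENNReal.ofReal (m * Real.exp (m * (Real.exp 2 - 1) - 2 * (T - 1))) :=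
        poisson_measure_ge_le hm zero_le_two (by linarith) hμ
    _ ≤ ENNReal.ofReal (m * (n : ℝ) ^ (-γ - 1)) := by
        rw [Real.rpow_def_of_pos hn0]
        gcongr
        have h1 : m * (Real.exp 2 - 1) ≤ m * 7 := by gcongr; linarith
        change _ ≤ L * (-γ - 1)
        linarith
end

section
/- Let f : ℝ → [0,∞) be a measurable integrable function and let h : ℝ → ℝ be measurable. Suppose there are constants 0 < I ≤ S and M > 0 such that for every x with h(x) ≠ 0 one has I·M ≤ |h(x)| ≤ S·M. Set Θ = S²/I², B = ∫ h(x) f(x) dx, σ² = ∫ h(x)² f(x) dx, and F = ∫_{{x : h(x) ≠ 0}} f(x) dx. Then for every t > 0: (i) if F ≤ Θ t, then B² ≤ Θ² σ² t; and (ii) if F > Θ t, then S·M·t ≤ σ √t. -/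
open MeasureTheory

/-- Weighted Cauchy–Schwarz inequality, with the weight restricted to the support of `h`. -/
theorem sq_integral_mul_le_integral_sq_mul_mul_setIntegral {α : Type*} [MeasurableSpace α]
    {μ : Measure α} {f h : α → ℝ} (hf0 : ∀ x, 0 ≤ f x) (hf : Integrable f μ)
    (hhf : Integrable (fun x => h x * f x) μ) (hhhf : Integrable (fun x => h x ^ 2 * f x) μ)
    (hs : MeasurableSet {x | h x ≠ 0}) :
    (∫ x, h x * f x ∂μ) ^ 2 ≤ (∫ x, h x ^ 2 * f x ∂μ) * ∫ x in {x | h x ≠ 0}, f x ∂μ := by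
  have hquad : ∀ c : ℝ, 0 ≤ (∫ x in {x | h x ≠ 0}, f x ∂μ) * (c * c)
      + (-2 * ∫ x, h x * f x ∂μ) * c + ∫ x, h x ^ 2 * f x ∂μ := by
    intro c
    have hind : Integrable ({x | h x ≠ 0}.indicator f) μ := hf.indicator hs
    have hlin : Integrable
        (fun x => {x | h x ≠ 0}.indicator f x * (c * c) + (h x * f x) * (-2 * c)) μ :=
      (hind.mul_const _).add (hhf.mul_const _)
    have hexpand : ∫ x, ({x | h x ≠ 0}.indicator f x * (c * c) + (h x * f x) * (-2 * c)
          + h x ^ 2 * f x) ∂μ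
        = (∫ x in {x | h x ≠ 0}, f x ∂μ) * (c * c)
          + (-2 * ∫ x, h x * f x ∂μ) * c + ∫ x, h x ^ 2 * f x ∂μ := by
      rw [integral_add hlin hhhf,
        integral_add (hind.mul_const _) (hhf.mul_const _), integral_mul_const,
        integral_mul_const, integral_indicator hs]
      ring
    rw [← hexpand]
    refine integral_nonneg fun x => ?_
    by_cases hx : h x = 0
    · simp [hx]
    · have hsq : 0 ≤ (h x - c) ^ 2 * f x := mul_nonneg (sq_nonneg _) (hf0 x)
      have hmem : x ∈ {x | h x ≠ 0} := hx
      simp only [Pi.zero_apply, Set.indicator_of_mem hmem]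
      linarith
  have hdiscrim := discrim_le_zero hquad
  rw [discrim] at hdiscrim
  linarith

/-- Lemma 4 of the paper in abstract form. Let `f ≥ 0` be integrable and `h` measurable with
`I·M ≤ |h(x)| ≤ S·M` wherever `h(x) ≠ 0`. Set `Θ = S²/I²`, `B = ∫ h f`, `σ² = ∫ h² f` and
`F = ∫_{h ≠ 0} f`. Then for `t > 0`: if `F ≤ Θ t` then `B² ≤ Θ² σ² t`, and if `F > Θ t`
then `S M t ≤ σ √t`. -/
theorem wavelet_coefficient_dichotomy (f h : ℝ → ℝ)
    (hfmeas : Measurable f) (hf0 : ∀ x, 0 ≤ f x) (hfint : Integrable f)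
    (hhmeas : Measurable h)
    (I S M : ℝ) (hI : 0 < I) (hIS : I ≤ S) (hM : 0 < M)
    (hbound : ∀ x, h x ≠ 0 → I * M ≤ |h x| ∧ |h x| ≤ S * M)
    (t : ℝ) (ht : 0 < t) :
    ((∫ x in {x | h x ≠ 0}, f x) ≤ (S ^ 2 / I ^ 2) * t →
      (∫ x, h x * f x) ^ 2 ≤ (S ^ 2 / I ^ 2) ^ 2 * (∫ x, (h x) ^ 2 * f x) * t) ∧
    ((S ^ 2 / I ^ 2) * t < (∫ x in {x | h x ≠ 0}, f x) →
      S * M * t ≤ Real.sqrt (∫ x, (h x) ^ 2 * f x) * Real.sqrt t) := by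
  have hs : MeasurableSet {x | h x ≠ 0} := hhmeas (measurableSet_singleton 0).compl
  have hS : 0 < S := hI.trans_le hIS
  have habs : ∀ x, |h x| ≤ S * M := by
    intro x
    by_cases hx : h x = 0
    · simpa [hx] using (mul_pos hS hM).le
    · exact (hbound x hx).2
  have hhf : Integrable (fun x => h x * f x) :=
    hfint.bdd_mul hhmeas.aestronglyMeasurable (Filter.Eventually.of_forall habs)
  have hhhf : Integrable (fun x => h x ^ 2 * f x) := by
    refine (hhf.bdd_mul hhmeas.aestronglyMeasurable (Filter.Eventually.of_forall habs)).congr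
      (Filter.Eventually.of_forall fun x => ?_)
    simp only
    ring
  have hvar : 0 ≤ ∫ x, h x ^ 2 * f x :=
    integral_nonneg fun x => mul_nonneg (sq_nonneg _) (hf0 x)
  constructor
  · intro hF
    have hΘ : 1 ≤ S ^ 2 / I ^ 2 := by
      rw [one_le_div (by positivity)]
      gcongr
    calc (∫ x, h x * f x) ^ 2
        ≤ (∫ x, h x ^ 2 * f x) * ∫ x in {x | h x ≠ 0}, f x :=
          sq_integral_mul_le_integral_sq_mul_mul_setIntegral hf0 hfint hhf hhhf hs
      _ ≤ (∫ x, h x ^ 2 * f x) * (S ^ 2 / I ^ 2 * t) := by gcongr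
      _ = S ^ 2 / I ^ 2 * ((∫ x, h x ^ 2 * f x) * t) := by ring
      _ ≤ (S ^ 2 / I ^ 2) ^ 2 * ((∫ x, h x ^ 2 * f x) * t) := by
          gcongr
          exact le_self_pow₀ hΘ two_ne_zero
      _ = (S ^ 2 / I ^ 2) ^ 2 * (∫ x, h x ^ 2 * f x) * t := by ring
  · intro hF
    have hlower : (I * M) ^ 2 * (∫ x in {x | h x ≠ 0}, f x) ≤ ∫ x, h x ^ 2 * f x := by
      rw [← integral_indicator hs, ← integral_const_mul]
      refine integral_mono ((hfint.indicator hs).const_mul _) hhhf fun x => ?_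
      by_cases hx : h x = 0
      · simp [hx]
      · have hmem : x ∈ {x | h x ≠ 0} := hx
        simp only [Set.indicator_of_mem hmem]
        rw [← sq_abs (h x)]
        have := hf0 x
        gcongr
        exact (hbound x hx).1
    rw [← Real.sqrt_mul hvar]
    refine Real.le_sqrt_of_sq_le ?_
    calc (S * M * t) ^ 2 = (I * M) ^ 2 * (S ^ 2 / I ^ 2 * t) * t := by
          field_simp
      _ ≤ (I * M) ^ 2 * (∫ x in {x | h x ≠ 0}, f x) * t := by gcongr
      _ ≤ (∫ x, h x ^ 2 * f x) * t := by gcongr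
end

section
/- Fix 0 < β < 1/2 and let f_β(x) = x^{−β} 1_{(0,1]}(x). Let β_{(j,k)} and σ_{(j,k)} be the Haar coefficients and variance factors of f_β. Then there exists a constant C depending only on β such that for every 0 < t < 1, ∑_{(j,k)∈Λ} β_{(j,k)}² · 1_{|β_{(j,k)}| ≤ t σ_{(j,k)}} ≤ C · t^{(2−4β)/3}. -/
open MeasureTheory Real

/-- The Haar scaling function `φ = 1_{[0,1)}`. -/
noncomputable def haarPhi (x : ℝ) : ℝ := if 0 ≤ x ∧ x < 1 then 1 else 0

/-- The Haar wavelet `ψ = 1_{[0,1/2)} - 1_{[1/2,1)}`. -/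
noncomputable def haarPsi (x : ℝ) : ℝ :=
  if 0 ≤ x ∧ x < 1 / 2 then 1 else if 1 / 2 ≤ x ∧ x < 1 then -1 else 0

/-- The dilated-translated Haar wavelet `ψ_{j,k}(x) = 2^{j/2} ψ(2^j x - k)` for `j ≥ 0`. -/
noncomputable def haarPsiJK (j : ℕ) (k : ℤ) (x : ℝ) : ℝ :=
  (2 : ℝ) ^ ((j : ℝ) / 2) * haarPsi ((2 : ℝ) ^ j * x - (k : ℝ))

/-- The translated Haar scaling function `φ_k(x) = φ(x - k)`. -/
noncomputable def haarPhiK (k : ℤ) (x : ℝ) : ℝ := haarPhi (x - (k : ℝ))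

/-- Scaling (level `j = -1`) Haar coefficient `β_{(-1,k)} = ∫ f φ_k`. -/
noncomputable def betaS (f : ℝ → ℝ) (k : ℤ) : ℝ := ∫ x, f x * haarPhiK k x

/-- Wavelet (level `j ≥ 0`) Haar coefficient `β_{(j,k)} = ∫ f ψ_{j,k}`. -/
noncomputable def betaW (f : ℝ → ℝ) (j : ℕ) (k : ℤ) : ℝ := ∫ x, f x * haarPsiJK j k x

/-- `σ_{(-1,k)} = (∫ φ_k² f)^{1/2}`. -/
noncomputable def sigmaS (f : ℝ → ℝ) (k : ℤ) : ℝ :=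
  Real.sqrt (∫ x, (haarPhiK k x) ^ 2 * f x)

/-- `σ_{(j,k)} = (∫ ψ_{j,k}² f)^{1/2}` for `j ≥ 0`. -/
noncomputable def sigmaW (f : ℝ → ℝ) (j : ℕ) (k : ℤ) : ℝ :=
  Real.sqrt (∫ x, (haarPsiJK j k x) ^ 2 * f x)

/-- The function `f_β(x) = x^{-β} 1_{(0,1]}(x)`. -/
noncomputable def fBeta (b : ℝ) (x : ℝ) : ℝ := if 0 < x ∧ x ≤ 1 then x ^ (-b) else 0

open Set

lemma fBeta_eq_indicator (b : ℝ) :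
    fBeta b = (Ioc (0 : ℝ) 1).indicator (fun x => x ^ (-b)) := by
  ext x
  simp [fBeta, indicator_apply]

lemma fBeta_nonneg (b x : ℝ) : 0 ≤ fBeta b x := by
  unfold fBeta
  split_ifs with h
  · exact rpow_nonneg h.1.le _
  · exact le_rfl

lemma fBeta_le_rpow (b : ℝ) {x : ℝ} (hx : 0 ≤ x) : fBeta b x ≤ x ^ (-b) := by
  unfold fBeta
  split_ifs
  · exact le_rfl
  · exact rpow_nonneg hx _

lemma fBeta_antitoneOn {b : ℝ} (hb : 0 ≤ b) : AntitoneOn (fBeta b) (Ioi 0) := by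
  intro x hx y hy hxy
  by_cases hy1 : y ≤ 1
  · have hx' : 0 < x := hx
    have hy' : 0 < y := hy
    simp only [fBeta, hx', hy', hy1, hxy.trans hy1, and_self, if_true]
    exact rpow_le_rpow_of_nonpos hx' hxy (by linarith)
  · have : fBeta b y = 0 := by simp [fBeta, hy1]
    rw [this]
    exact fBeta_nonneg b x

lemma integrable_fBeta {b : ℝ} (hb : b < 1) : Integrable (fBeta b) := by
  rw [fBeta_eq_indicator, integrable_indicator_iff measurableSet_Ioc,
    ← intervalIntegrable_iff_integrableOn_Ioc_of_le zero_le_one]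
  exact intervalIntegral.intervalIntegrable_rpow' (by linarith)

lemma intervalIntegral_fBeta_nonneg (b : ℝ) {c d : ℝ} (h : c ≤ d) :
    0 ≤ ∫ x in c..d, fBeta b x :=
  intervalIntegral.integral_nonneg_of_forall h fun x => fBeta_nonneg b x

lemma intervalIntegral_fBeta_le {b : ℝ} (hb0 : 0 ≤ b) (hb : b < 1) {c d : ℝ} (hc : 0 < c)
    (h : c ≤ d) : ∫ x in c..d, fBeta b x ≤ (d - c) * fBeta b c := by
  have := intervalIntegral.integral_mono_on h (integrable_fBeta hb).intervalIntegrable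
    (intervalIntegrable_const (c := fBeta b c)) (μ := volume)
    fun x hx => fBeta_antitoneOn hb0 hc (hc.trans_le hx.1) hx.1
  simpa using this

lemma le_intervalIntegral_fBeta {b : ℝ} (hb0 : 0 ≤ b) (hb : b < 1) {c d : ℝ} (hc : 0 < c)
    (h : c ≤ d) : (d - c) * fBeta b d ≤ ∫ x in c..d, fBeta b x := by
  have := intervalIntegral.integral_mono_on h
    (intervalIntegrable_const (c := fBeta b d)) (integrable_fBeta hb).intervalIntegrable
    (μ := volume)
    fun x hx => fBeta_antitoneOn hb0 (hc.trans_le hx.1) (hc.trans_le h) hx.2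
  simpa using this

lemma intervalIntegral_fBeta_zero_le {b : ℝ} (hb : b < 1) {h : ℝ} (h0 : 0 ≤ h) :
    ∫ x in (0 : ℝ)..h, fBeta b x ≤ h ^ (1 - b) / (1 - b) := by
  have h1 := intervalIntegral.integral_mono_on h0 (integrable_fBeta hb).intervalIntegrable
    (intervalIntegral.intervalIntegrable_rpow' (by linarith : -1 < -b)) (μ := volume)
    fun x hx => fBeta_le_rpow b hx.1
  rw [integral_rpow (Or.inl (by linarith)), zero_rpow (by linarith),
    show -b + 1 = 1 - b by ring, sub_zero] at h1
  exact h1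

lemma intervalIntegral_fBeta_of_nonpos (b : ℝ) {c d : ℝ} (h : c ≤ d) (hd : d ≤ 0) :
    ∫ x in c..d, fBeta b x = 0 := by
  rw [intervalIntegral.integral_of_le h]
  refine setIntegral_eq_zero_of_forall_eq_zero fun x hx => ?_
  simp [fBeta, (hx.2.trans hd).not_gt]

lemma intervalIntegral_fBeta_of_one_le (b : ℝ) {c d : ℝ} (h : c ≤ d) (hc : 1 ≤ c) :
    ∫ x in c..d, fBeta b x = 0 := by
  rw [intervalIntegral.integral_of_le h]
  refine setIntegral_eq_zero_of_forall_eq_zero fun x hx => ?_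
  simp [fBeta, (hc.trans_lt hx.1).not_ge]

lemma intervalIntegral_eq_integral_indicator_Ico (f : ℝ → ℝ) {c d : ℝ} (h : c ≤ d) :
    ∫ x in c..d, f x = ∫ x, (Ico c d).indicator f x := by
  rw [intervalIntegral.integral_of_le h, integral_indicator measurableSet_Ico,
    integral_Ico_eq_integral_Ioc]

lemma betaS_eq (f : ℝ → ℝ) (k : ℤ) : betaS f k = ∫ x in (k : ℝ)..(k + 1), f x := by
  rw [intervalIntegral_eq_integral_indicator_Ico f (by linarith), betaS]
  congr 1 with x
  simp only [haarPhiK, haarPhi, indicator_apply, mem_Ico, sub_nonneg, sub_lt_iff_lt_add']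
  split_ifs <;> simp

lemma sigmaS_eq (f : ℝ → ℝ) (k : ℤ) : sigmaS f k = √(∫ x in (k : ℝ)..(k + 1), f x) := by
  rw [intervalIntegral_eq_integral_indicator_Ico f (by linarith), sigmaS]
  congr 2 with x
  simp only [haarPhiK, haarPhi, indicator_apply, mem_Ico, sub_nonneg, sub_lt_iff_lt_add']
  split_ifs <;> simp

lemma haarPsi_dilate {N : ℝ} (hN : 0 < N) (k x : ℝ) :
    haarPsi (N * x - k) = if x ∈ Ico (k / N) ((k + 1 / 2) / N) then 1 else
      if x ∈ Ico ((k + 1 / 2) / N) ((k + 1) / N) then -1 else 0 := by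
  simp only [haarPsi, mem_Ico, div_le_iff₀ hN, lt_div_iff₀ hN, zero_add, sub_lt_iff_lt_add',
    le_sub_iff_add_le, mul_comm x N, add_comm (1 / 2 : ℝ) k]

lemma betaW_eq {f : ℝ → ℝ} (hf : Integrable f) (j : ℕ) (k : ℤ) :
    betaW f j k = (2 : ℝ) ^ ((j : ℝ) / 2) *
      ((∫ x in ((k : ℝ) / 2 ^ j)..((k + 1 / 2) / 2 ^ j), f x) -
        ∫ x in (((k : ℝ) + 1 / 2) / 2 ^ j)..((k + 1) / 2 ^ j), f x) := by
  have hN : (0 : ℝ) < 2 ^ j := by positivity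
  rw [intervalIntegral_eq_integral_indicator_Ico f (by gcongr; linarith),
    intervalIntegral_eq_integral_indicator_Ico f (by gcongr; linarith),
    ← integral_sub (hf.indicator measurableSet_Ico) (hf.indicator measurableSet_Ico),
    ← integral_const_mul, betaW]
  congr 1 with x
  rw [haarPsiJK, haarPsi_dilate hN]
  by_cases h1 : x ∈ Ico ((k : ℝ) / 2 ^ j) ((k + 1 / 2) / 2 ^ j)
  · have h2 : x ∉ Ico (((k : ℝ) + 1 / 2) / 2 ^ j) ((k + 1) / 2 ^ j) :=
      fun h => absurd h.1 h1.2.not_ge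
    rw [indicator_of_mem h1, indicator_of_notMem h2, if_pos h1]
    ring
  · rw [indicator_of_notMem h1, if_neg h1, indicator_apply]
    split_ifs <;> ring

lemma sigmaW_eq (f : ℝ → ℝ) (j : ℕ) (k : ℤ) :
    sigmaW f j k = √((2 : ℝ) ^ j * ∫ x in ((k : ℝ) / 2 ^ j)..((k + 1) / 2 ^ j), f x) := by
  have hN : (0 : ℝ) < 2 ^ j := by positivity
  have hsq : ((2 : ℝ) ^ ((j : ℝ) / 2)) ^ 2 = 2 ^ j := by
    rw [← rpow_natCast, ← rpow_mul (by norm_num), ← rpow_natCast]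
    norm_num
  rw [intervalIntegral_eq_integral_indicator_Ico f (by gcongr; linarith),
    ← integral_const_mul, sigmaW]
  congr 2 with x
  rw [haarPsiJK, haarPsi_dilate hN, mul_pow, hsq, mul_assoc]
  congr 1
  have hm1 : ((k : ℝ) + 1 / 2) / 2 ^ j ≤ (k + 1) / 2 ^ j := by gcongr; norm_num
  have hm0 : (k : ℝ) / 2 ^ j ≤ (k + 1 / 2) / 2 ^ j := by gcongr; norm_num
  simp only [indicator_apply, mem_Ico]
  split_ifs <;> first | (norm_num; done) | (exfalso; grind)

/-- The Haar coefficients of `fBeta b` outside the unit interval vanish. -/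
lemma betaW_fBeta_eq_zero {b : ℝ} (hb : b < 1) (j : ℕ) (k : ℤ) (hk : k < 0 ∨ 2 ^ j ≤ k) :
    betaW (fBeta b) j k = 0 := by
  have hN : (0 : ℝ) < 2 ^ j := by positivity
  have hm1 : ((k : ℝ) + 1 / 2) / 2 ^ j ≤ (k + 1) / 2 ^ j := by gcongr; norm_num
  have hm0 : (k : ℝ) / 2 ^ j ≤ (k + 1 / 2) / 2 ^ j := by gcongr; norm_num
  rw [betaW_eq (integrable_fBeta hb)]
  rcases hk with hk | hk
  · have hk' : (k : ℝ) + 1 ≤ 0 := by exact_mod_cast hk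
    have h1 : ((k : ℝ) + 1) / 2 ^ j ≤ 0 := div_nonpos_of_nonpos_of_nonneg hk' hN.le
    rw [intervalIntegral_fBeta_of_nonpos b hm0 (hm1.trans h1),
      intervalIntegral_fBeta_of_nonpos b hm1 h1]
    simp
  · have hk' : (2 : ℝ) ^ j ≤ k := by exact_mod_cast hk
    have h1 : 1 ≤ (k : ℝ) / 2 ^ j := (one_le_div hN).2 hk'
    rw [intervalIntegral_fBeta_of_one_le b hm0 h1,
      intervalIntegral_fBeta_of_one_le b hm1 (h1.trans hm0)]
    simp

lemma rpow_neg_sub_rpow_neg_le {b x : ℝ} (hb0 : 0 ≤ b) (hb : b ≤ 1) (hx : 1 ≤ x) :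
    x ^ (-b) - (x + 1) ^ (-b) ≤ 1 / (x + 1) := by
  have hx0 : 0 < x := by linarith
  have h1 : x / (x + 1) ≤ (x / (x + 1)) ^ b := by
    have := rpow_le_rpow_of_exponent_ge (x := x / (x + 1)) (by positivity)
      ((div_le_one (by positivity)).2 (by linarith)) hb
    simpa using this
  have h2 : x ^ (-b) ≤ 1 := rpow_le_one_of_one_le_of_nonpos hx (by linarith)
  have h3 : (x + 1) ^ (-b) = x ^ (-b) * (x / (x + 1)) ^ b := by
    rw [div_rpow hx0.le (by positivity), rpow_neg hx0.le, rpow_neg (by positivity)]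
    have := (rpow_pos_of_pos hx0 b).ne'
    field_simp
  have h4 : 1 - x / (x + 1) = 1 / (x + 1) := by field_simp; ring
  have h5 : 0 ≤ 1 - x / (x + 1) := by rw [h4]; positivity
  have h6 : 0 ≤ x ^ (-b) := rpow_nonneg hx0.le _
  rw [h3, ← h4]
  nlinarith

lemma abs_betaW_fBeta_le {b : ℝ} (hb0 : 0 < b) (hb : b < 1 / 2) (j : ℕ) (k : ℤ) :
    |betaW (fBeta b) j k| ≤ 2 * ((2 : ℝ) ^ j) ^ (-(1 / 2 - b)) * (|(k : ℝ)| + 1)⁻¹ := by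
  by_cases hk : k < 0 ∨ 2 ^ j ≤ k
  · rw [betaW_fBeta_eq_zero (by linarith) j k hk, abs_zero]
    positivity
  push Not at hk
  obtain ⟨hk0, hk1⟩ := hk
  have hk0' : (0 : ℝ) ≤ k := by exact_mod_cast hk0
  have hk1' : (k : ℝ) + 1 ≤ 2 ^ j := by exact_mod_cast hk1
  rw [betaW_eq (integrable_fBeta (by linarith)), abs_of_nonneg hk0',
    show (2 : ℝ) ^ ((j : ℝ) / 2) = ((2 : ℝ) ^ j) ^ (1 / 2 : ℝ) by
      rw [← rpow_natCast, ← rpow_mul (by norm_num)]; ring_nf]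
  generalize hNdef : (2 : ℝ) ^ j = N at *
  have hN : 0 < N := by rw [← hNdef]; positivity
  have hm1 : ((k : ℝ) + 1 / 2) / N ≤ (k + 1) / N := by gcongr; norm_num
  have hm0 : (k : ℝ) / N ≤ (k + 1 / 2) / N := by gcongr; norm_num
  have hexp : N ^ (1 / 2 : ℝ) * (N⁻¹) ^ (1 - b) = N ^ (-(1 / 2 - b)) := by
    rw [inv_rpow hN.le, ← rpow_neg hN.le, ← rpow_add hN]
    ring_nf
  rw [abs_mul, abs_of_nonneg (rpow_nonneg hN.le _), ← hexp, mul_comm 2, mul_assoc, mul_assoc]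
  refine mul_le_mul_of_nonneg_left ?_ (rpow_nonneg hN.le _)
  have i0 := intervalIntegral_fBeta_nonneg b hm0
  have i1 := intervalIntegral_fBeta_nonneg b hm1
  have hpos : 0 ≤ (N⁻¹) ^ (1 - b) := by positivity
  rcases hk0.eq_or_lt with rfl | hkp
  · have hs := intervalIntegral.integral_add_adjacent_intervals
      ((integrable_fBeta (b := b) (by linarith)).intervalIntegrable
        (a := ((0 : ℤ) : ℝ) / N) (b := (((0 : ℤ) : ℝ) + 1 / 2) / N))
      ((integrable_fBeta (b := b) (by linarith)).intervalIntegrable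
        (a := (((0 : ℤ) : ℝ) + 1 / 2) / N) (b := (((0 : ℤ) : ℝ) + 1) / N))
    have hle := intervalIntegral_fBeta_zero_le (b := b) (by linarith) (inv_nonneg.2 hN.le)
    have h2 : (N⁻¹) ^ (1 - b) / (1 - b) ≤ (N⁻¹) ^ (1 - b) * 2 := by
      rw [div_le_iff₀ (by linarith)]
      nlinarith
    have hs' : ∫ x in (((0 : ℤ) : ℝ) / N)..((((0 : ℤ) : ℝ) + 1) / N), fBeta b x =
      ∫ x in (0 : ℝ)..N⁻¹, fBeta b x := by simp
    rw [hs'] at hs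
    have : (2 : ℝ) * (((0 : ℤ) : ℝ) + 1)⁻¹ = 2 := by simp
    rw [this, abs_le]
    constructor <;> linarith
  · have hkp' : (1 : ℝ) ≤ k := by exact_mod_cast hkp
    have ha : 0 < (k : ℝ) / N := by positivity
    have u0 := intervalIntegral_fBeta_le hb0.le (by linarith) ha hm0
    have l0 := le_intervalIntegral_fBeta hb0.le (by linarith) ha hm0
    have u1 := intervalIntegral_fBeta_le hb0.le (by linarith) (ha.trans_le hm0) hm1
    have l1 := le_intervalIntegral_fBeta hb0.le (by linarith) (ha.trans_le hm0) hm1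
    have e0 : ((k : ℝ) + 1 / 2) / N - k / N = N⁻¹ / 2 := by field_simp; ring
    have e1 : ((k : ℝ) + 1) / N - (k + 1 / 2) / N = N⁻¹ / 2 := by field_simp; ring
    rw [e0] at u0 l0
    rw [e1] at u1 l1
    have hval : ∀ y : ℝ, 0 < y → y ≤ N → fBeta b (y / N) = (N⁻¹) ^ (-b) * y ^ (-b) := by
      intro y hy hyN
      rw [fBeta, if_pos ⟨by positivity, (div_le_one hN).2 hyN⟩, div_eq_inv_mul,
        mul_rpow (by positivity) hy.le]
    rw [hval k (by linarith) (by linarith)] at u0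
    rw [hval (k + 1) (by linarith) hk1'] at l1
    have hp := rpow_neg_sub_rpow_neg_le hb0.le (by linarith) hkp'
    have hsplit : (N⁻¹) ^ (1 - b) = N⁻¹ * (N⁻¹) ^ (-b) := by
      rw [sub_eq_add_neg, rpow_add (by positivity), rpow_one]
    rw [hsplit] at hpos ⊢
    have hmul := mul_le_mul_of_nonneg_left hp hpos
    rw [one_div] at hmul
    have hq : 0 ≤ N⁻¹ * (N⁻¹) ^ (-b) * ((k : ℝ) + 1)⁻¹ := by positivity
    rw [abs_of_nonneg (by linarith)]
    nlinarith

lemma sigmaW_fBeta_le {b : ℝ} (hb0 : 0 < b) (hb : b < 1 / 2) (j : ℕ) (k : ℤ) :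
    sigmaW (fBeta b) j k ≤ 2 * ((2 : ℝ) ^ j) ^ (b / 2) := by
  rw [sigmaW_eq]
  generalize hNdef : (2 : ℝ) ^ j = N at *
  have hN : 0 < N := by rw [← hNdef]; positivity
  refine sqrt_le_iff.2 ⟨by positivity, ?_⟩
  have hsq : (2 * N ^ (b / 2)) ^ 2 = 4 * N ^ b := by
    rw [mul_pow, ← rpow_natCast (N ^ (b / 2)), ← rpow_mul hN.le]
    norm_num
  have hm : (k : ℝ) / N ≤ (k + 1) / N := by gcongr; norm_num
  have hexp : N * (N⁻¹) ^ (1 - b) = N ^ b := by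
    rw [inv_rpow hN.le, ← rpow_neg hN.le]
    nth_rw 1 [← rpow_one N]
    rw [← rpow_add hN]
    ring_nf
  have hpos : 0 ≤ (N⁻¹) ^ (1 - b) := by positivity
  have key : ∫ x in ((k : ℝ) / N)..((k + 1) / N), fBeta b x ≤ (N⁻¹) ^ (1 - b) * 2 := by
    rcases lt_trichotomy k 0 with hk | rfl | hk
    · have hk' : (k : ℝ) + 1 ≤ 0 := by exact_mod_cast hk
      rw [intervalIntegral_fBeta_of_nonpos b hm (div_nonpos_of_nonpos_of_nonneg hk' hN.le)]
      positivity
    · have hle := intervalIntegral_fBeta_zero_le (b := b) (by linarith) (inv_nonneg.2 hN.le)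
      have h2 : (N⁻¹) ^ (1 - b) / (1 - b) ≤ (N⁻¹) ^ (1 - b) * 2 := by
        rw [div_le_iff₀ (by linarith)]
        nlinarith
      simpa using hle.trans h2
    · have hk' : (1 : ℝ) ≤ k := by exact_mod_cast hk
      have hi : 0 < N⁻¹ := by positivity
      have hik : N⁻¹ ≤ (k : ℝ) / N := by rw [← one_div]; gcongr
      have u := intervalIntegral_fBeta_le hb0.le (by linarith) (hi.trans_le hik) hm
      have v := (fBeta_antitoneOn hb0.le hi (hi.trans_le hik) hik).trans
        (fBeta_le_rpow b hi.le)
      have e : ((k : ℝ) + 1) / N - k / N = N⁻¹ := by field_simp; ring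
      have hsplit : (N⁻¹) ^ (1 - b) = N⁻¹ * (N⁻¹) ^ (-b) := by
        rw [sub_eq_add_neg, rpow_add (by positivity), rpow_one]
      rw [e] at u
      have w := mul_le_mul_of_nonneg_left v hi.le
      linarith
  have := mul_le_mul_of_nonneg_left key hN.le
  rw [hsq, ← hexp]
  nlinarith [mul_nonneg hN.le hpos]

lemma betaS_fBeta_eq_zero (b : ℝ) {k : ℤ} (hk : k ≠ 0) : betaS (fBeta b) k = 0 := by
  rw [betaS_eq]
  rcases hk.lt_or_gt with hk | hk
  · exact intervalIntegral_fBeta_of_nonpos b (by linarith) (by exact_mod_cast hk)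
  · exact intervalIntegral_fBeta_of_one_le b (by linarith) (by exact_mod_cast hk)

/-- Interpolation between a coefficient and the threshold that dominates it. -/
lemma sq_mul_ite_le {β σ B S t p : ℝ} (ht : 0 ≤ t) (hp : 0 ≤ p) (hp2 : p ≤ 2) (hβ : |β| ≤ B)
    (hσ : σ ≤ S) (hS : 0 ≤ S) :
    (β ^ 2 * if |β| ≤ t * σ then 1 else 0) ≤ B ^ (2 - p) * (t * S) ^ p := by
  have hB : 0 ≤ B := (abs_nonneg β).trans hβ
  split_ifs with h
  · have h1 : β ^ 2 = |β| ^ (2 - p) * |β| ^ p := by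
      rw [← rpow_add_of_nonneg (abs_nonneg β) (by linarith) hp, sub_add_cancel, rpow_two, sq_abs]
    rw [mul_one, h1]
    have h2 : |β| ≤ t * S := h.trans (by gcongr)
    have := rpow_le_rpow (abs_nonneg β) h2 hp
    have := rpow_le_rpow (abs_nonneg β) hβ (by linarith : 0 ≤ 2 - p)
    gcongr
  · rw [mul_zero]
    positivity

lemma summable_int_inv_rpow {s : ℝ} (hs : 1 < s) :
    Summable fun k : ℤ => ((|(k : ℝ)| + 1)⁻¹) ^ s := by
  have h : Summable fun n : ℕ => (((n : ℝ) + 1)⁻¹) ^ s := by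
    have := (summable_nat_add_iff 1).2 (Real.summable_nat_rpow_inv.2 hs)
    refine this.congr fun n => ?_
    rw [inv_rpow (by positivity)]
    push_cast
    rfl
  refine Summable.of_nat_of_neg ?_ ?_ <;> simpa using h

lemma term_bound {b t : ℝ} (hb0 : 0 < b) (hb : b < 1 / 2) (ht : 0 < t) (j : ℕ) (k : ℤ) {p : ℝ}
    (hp : 0 ≤ p) (hp2 : p ≤ 2) :
    ((betaW (fBeta b) j k) ^ 2 *
        if |betaW (fBeta b) j k| ≤ t * sigmaW (fBeta b) j k then 1 else 0) ≤
      4 * t ^ p * ((2 : ℝ) ^ (-(1 / 2 - b) * (2 - p) + b / 2 * p)) ^ j *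
        ((|(k : ℝ)| + 1)⁻¹) ^ (2 - p) := by
  refine (sq_mul_ite_le ht.le hp hp2 (abs_betaW_fBeta_le hb0 hb j k)
    (sigmaW_fBeta_le hb0 hb j k) (by positivity)).trans_eq ?_
  have h4 : (4 : ℝ) = 2 ^ (2 - p) * 2 ^ p := by
    rw [← rpow_add (by norm_num), sub_add_cancel]
    norm_num
  have hj : ((2 : ℝ) ^ (-(1 / 2 - b) * (2 - p) + b / 2 * p)) ^ j =
      (((2 : ℝ) ^ j) ^ (-(1 / 2 - b))) ^ (2 - p) * (((2 : ℝ) ^ j) ^ (b / 2)) ^ p := by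
    have h2 : (0 : ℝ) < 2 ^ j := by positivity
    rw [← rpow_mul h2.le, ← rpow_mul h2.le, ← rpow_add h2, ← rpow_natCast, ← rpow_mul (by norm_num),
      ← rpow_natCast, ← rpow_mul (by norm_num), mul_comm]
  rw [mul_rpow (by positivity) (by positivity), mul_rpow (by positivity) (by positivity),
    mul_rpow (by positivity) (by positivity), mul_rpow (by positivity) (by positivity), hj, h4]
  ring

/-- Key step of the proof of Proposition 2: for `0 < β < 1/2` and `f_β(x) = x^{-β} 1_{(0,1]}(x)`,
there is a constant `C` depending only on `β` such that for all `0 < t < 1`,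
`∑_{(j,k)} β_{(j,k)}² 1_{|β_{(j,k)}| ≤ t σ_{(j,k)}} ≤ C t^{(2-4β)/3}`. -/
theorem fBeta_weak_besov (b : ℝ) (hb0 : 0 < b) (hb : b < 1 / 2) :
    ∃ C : ℝ, 0 < C ∧ ∀ t : ℝ, 0 < t → t < 1 →
      (∑' k : ℤ, ENNReal.ofReal
          ((betaS (fBeta b) k) ^ 2 * if |betaS (fBeta b) k| ≤ t * sigmaS (fBeta b) k then 1 else 0))
        + (∑' j : ℕ, ∑' k : ℤ, ENNReal.ofReal
            ((betaW (fBeta b) j k) ^ 2 *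
              if |betaW (fBeta b) j k| ≤ t * sigmaW (fBeta b) j k then 1 else 0))
      ≤ ENNReal.ofReal (C * t ^ ((2 - 4 * b) / 3)) := by
  set p : ℝ := (2 - 4 * b) / 3 with hp
  have hp0 : 0 ≤ p := by rw [hp]; linarith
  have hp1 : p < 1 := by rw [hp]; linarith
  set q : ℝ := (2 : ℝ) ^ (-(1 / 2 - b) * (2 - p) + b / 2 * p) with hq
  have hq0 : 0 ≤ q := by positivity
  have hq1 : q < 1 := by
    refine rpow_lt_one_of_one_lt_of_neg (by norm_num) ?_
    rw [hp]
    nlinarith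
  have hv := summable_int_inv_rpow (show 1 < 2 - p by linarith)
  have hv0 : ∀ k : ℤ, 0 ≤ ((|(k : ℝ)| + 1)⁻¹) ^ (2 - p) := fun k => by positivity
  set V : ℝ := ∑' k : ℤ, ((|(k : ℝ)| + 1)⁻¹) ^ (2 - p) with hV
  have hV0 : 0 ≤ V := tsum_nonneg hv0
  have hg := summable_geometric_of_lt_one hq0 hq1
  set G : ℝ := ∑' j : ℕ, q ^ j with hG
  have hG0 : 0 ≤ G := tsum_nonneg fun j => by positivity
  refine ⟨4 + 4 * G * V, by positivity, fun t ht _ => ?_⟩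
  have htp : 0 ≤ t ^ p := by positivity
  have hS : ∑' k : ℤ, ENNReal.ofReal ((betaS (fBeta b) k) ^ 2 *
      if |betaS (fBeta b) k| ≤ t * sigmaS (fBeta b) k then 1 else 0) ≤
      ENNReal.ofReal (4 * t ^ p) := by
    rw [tsum_eq_single 0 fun k hk => by simp [betaS_fBeta_eq_zero b hk]]
    refine ENNReal.ofReal_le_ofReal ?_
    have hI0 : 0 ≤ ∫ x in (0 : ℝ)..1, fBeta b x := intervalIntegral_fBeta_nonneg b zero_le_one
    have hI : ∫ x in (0 : ℝ)..1, fBeta b x ≤ 2 := by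
      refine (intervalIntegral_fBeta_zero_le (by linarith) zero_le_one).trans ?_
      rw [one_rpow, div_le_iff₀ (by linarith)]
      linarith
    have hβ : |betaS (fBeta b) 0| ≤ 2 := by
      rw [betaS_eq]
      simpa [abs_of_nonneg hI0] using hI
    have hσ : sigmaS (fBeta b) 0 ≤ 2 := by
      rw [sigmaS_eq]
      refine sqrt_le_iff.2 ⟨by norm_num, ?_⟩
      norm_num
      linarith
    refine (sq_mul_ite_le ht.le hp0 (by linarith) hβ hσ (by norm_num)).trans_eq ?_
    rw [mul_rpow ht.le (by norm_num), mul_left_comm, ← rpow_add (by norm_num), sub_add_cancel,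
      mul_comm]
    norm_num
  have hW : ∑' j : ℕ, ∑' k : ℤ, ENNReal.ofReal ((betaW (fBeta b) j k) ^ 2 *
      if |betaW (fBeta b) j k| ≤ t * sigmaW (fBeta b) j k then 1 else 0) ≤
      ENNReal.ofReal (4 * t ^ p * G * V) := by
    calc _ ≤ ∑' j : ℕ, ∑' k : ℤ, ENNReal.ofReal
          (4 * t ^ p * q ^ j * ((|(k : ℝ)| + 1)⁻¹) ^ (2 - p)) :=
          ENNReal.tsum_le_tsum fun j => ENNReal.tsum_le_tsum fun k =>
            ENNReal.ofReal_le_ofReal (term_bound hb0 hb ht j k hp0 (by linarith))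
      _ = ∑' j : ℕ, ENNReal.ofReal (4 * t ^ p * q ^ j * V) := by
          refine tsum_congr fun j => ?_
          rw [← ENNReal.ofReal_tsum_of_nonneg
            (fun k => mul_nonneg (by positivity) (hv0 k)) (hv.mul_left _), tsum_mul_left]
      _ = ENNReal.ofReal (4 * t ^ p * G * V) := by
          rw [← ENNReal.ofReal_tsum_of_nonneg (fun j => by positivity)
            ((hg.mul_left _).mul_right _), tsum_mul_right, tsum_mul_left]
  refine (add_le_add hS hW).trans_eq ?_
  rw [← ENNReal.ofReal_add (by positivity) (by positivity)]
  ring_nf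
end

section
/- Let Λ be a countable index set, let (β_λ)_{λ∈Λ} be real numbers and (σ_λ)_{λ∈Λ} nonnegative real numbers, let 0 < s < 1/2 and R > 0, and suppose that for every t > 0, ∑_{λ∈Λ} β_λ² · 1_{|β_λ| ≤ σ_λ t} ≤ R^{2−4s} t^{4s}. Then for every u > 0, ∑_{λ∈Λ} σ_λ² u² · 1_{|β_λ| > σ_λ u} ≤ C(s) · R^{2−4s} u^{4s}, where C(s) = ∑_{k=0}^{∞} 2^{−k + 2s(k+1)} = 2^{2s}/(1 − 2^{2s−1}) < ∞. -/
open ENNReal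

/-- A weight `b` exceeded by `a` is dominated by the shells `a ≤ b * √2 ^ (k + 1)`, with
geometrically decaying coefficients. -/
theorem sq_indicator_le_tsum_shells (a b : ℝ) (hb : 0 ≤ b) :
    ENNReal.ofReal (b ^ 2 * if b < |a| then 1 else 0) ≤
      ∑' k : ℕ, ENNReal.ofReal ((1 / 2 : ℝ) ^ k) *
        ENNReal.ofReal (a ^ 2 * if |a| ≤ b * √2 ^ (k + 1) then 1 else 0) := by
  rcases hb.eq_or_lt with rfl | hb
  · simp
  split_ifs with hab
  swap
  · simp
  have h2 : (1 : ℝ) < √2 := by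
    rw [Real.lt_sqrt] <;> norm_num
  obtain ⟨k, hk, hk'⟩ := exists_nat_pow_near ((one_le_div hb).2 hab.le) h2
  rw [le_div_iff₀ hb] at hk
  rw [div_lt_iff₀ hb, mul_comm] at hk'
  refine le_trans ?_ (ENNReal.le_tsum k)
  rw [if_pos hk'.le, ← ENNReal.ofReal_mul (by positivity)]
  apply ENNReal.ofReal_le_ofReal
  have hsq : (√2 ^ k * b) ^ 2 ≤ a ^ 2 := by
    rw [← sq_abs a]
    gcongr
  rw [mul_pow, ← pow_mul, mul_comm k 2, pow_mul, Real.sq_sqrt (by norm_num)] at hsq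
  calc b ^ 2 * 1 = (1 / 2 : ℝ) ^ k * (2 ^ k * b ^ 2) := by
        rw [← mul_assoc, ← mul_pow]; norm_num
    _ ≤ (1 / 2 : ℝ) ^ k * (a ^ 2 * 1) := by rw [mul_one]; gcongr

theorem sqrt_two_pow_rpow (s : ℝ) (n : ℕ) :
    (√2 ^ n) ^ (4 * s) = ((2 : ℝ) ^ (2 * s)) ^ n := by
  rw [Real.sqrt_eq_rpow, ← Real.rpow_natCast, ← Real.rpow_natCast, ← Real.rpow_mul (by positivity),
    ← Real.rpow_mul (by positivity), ← Real.rpow_mul (by positivity)]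
  ring_nf

theorem hasSum_shell_bounds (s M u : ℝ) (hs : s < 1 / 2) (hu : 0 < u) :
    HasSum (fun k : ℕ => (1 / 2 : ℝ) ^ k * (M * (u * √2 ^ (k + 1)) ^ (4 * s)))
      ((2 : ℝ) ^ (2 * s) / (1 - (2 : ℝ) ^ (2 * s - 1)) * (M * u ^ (4 * s))) := by
  have hlt : (2 : ℝ) ^ (2 * s - 1) < 1 :=
    Real.rpow_lt_one_of_one_lt_of_neg (by norm_num) (by linarith)
  have hgeom := (hasSum_geometric_of_lt_one (by positivity) hlt).mul_left
    ((2 : ℝ) ^ (2 * s) * (M * u ^ (4 * s)))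
  rw [div_mul_eq_mul_div, div_eq_mul_inv]
  refine (congrArg (HasSum · _) (funext fun k => ?_)).mpr hgeom
  rw [Real.mul_rpow hu.le (by positivity), sqrt_two_pow_rpow,
    Real.rpow_sub_one (by norm_num) (2 * s), div_eq_mul_one_div ((2 : ℝ) ^ (2 * s)) 2, mul_pow]
  ring

/-- Dyadic peeling lemma from the proof of Theorem 2: if the coefficients `β` belong to the
weak Besov ball `W_s(R)` with respect to the weights `σ`, i.e. for every `t > 0`,
`∑_λ β_λ² 1_{|β_λ| ≤ σ_λ t} ≤ R^{2-4s} t^{4s}`, then for every `u > 0`,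
`∑_λ σ_λ² u² 1_{|β_λ| > σ_λ u} ≤ C(s) R^{2-4s} u^{4s}` with
`C(s) = 2^{2s} / (1 - 2^{2s-1})`. -/
theorem weak_besov_variance_control {Λ : Type*} [Countable Λ]
    (β σ : Λ → ℝ) (hσ : ∀ l, 0 ≤ σ l)
    (s R : ℝ) (hs0 : 0 < s) (hs : s < 1 / 2) (hR : 0 < R)
    (hW : ∀ t : ℝ, 0 < t →
      (∑' l : Λ, ENNReal.ofReal ((β l) ^ 2 * if |β l| ≤ σ l * t then 1 else 0))
        ≤ ENNReal.ofReal (R ^ (2 - 4 * s) * t ^ (4 * s))) :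
    ∀ u : ℝ, 0 < u →
      (∑' l : Λ, ENNReal.ofReal ((σ l) ^ 2 * u ^ 2 * if σ l * u < |β l| then 1 else 0))
        ≤ ENNReal.ofReal
            (((2 : ℝ) ^ (2 * s) / (1 - (2 : ℝ) ^ (2 * s - 1))) *
              (R ^ (2 - 4 * s) * u ^ (4 * s))) := by
  intro u hu
  have hsum := hasSum_shell_bounds s (R ^ (2 - 4 * s)) u hs hu
  calc
    _ ≤ ∑' l : Λ, ∑' k : ℕ, ENNReal.ofReal ((1 / 2 : ℝ) ^ k) *
          ENNReal.ofReal ((β l) ^ 2 * if |β l| ≤ σ l * (u * √2 ^ (k + 1)) then 1 else 0) := by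
        refine ENNReal.tsum_le_tsum fun l => ?_
        simpa only [mul_pow, mul_assoc] using
          sq_indicator_le_tsum_shells (β l) (σ l * u) (mul_nonneg (hσ l) hu.le)
    _ = ∑' k : ℕ, ENNReal.ofReal ((1 / 2 : ℝ) ^ k) * ∑' l : Λ,
          ENNReal.ofReal ((β l) ^ 2 * if |β l| ≤ σ l * (u * √2 ^ (k + 1)) then 1 else 0) := by
        rw [ENNReal.tsum_comm]
        simp only [ENNReal.tsum_mul_left]
    _ ≤ ∑' k : ℕ, ENNReal.ofReal
          ((1 / 2 : ℝ) ^ k * (R ^ (2 - 4 * s) * (u * √2 ^ (k + 1)) ^ (4 * s))) := by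
        refine ENNReal.tsum_le_tsum fun k => ?_
        rw [ENNReal.ofReal_mul (by positivity)]
        gcongr
        exact hW _ (by positivity)
    _ = _ := by
        rw [← ENNReal.ofReal_tsum_of_nonneg (fun k => by positivity) hsum.summable, hsum.tsum_eq]
end

section
/- Let ρ > 0 and let g, h : ℝ → ℝ be measurable functions such that (g − h)² is integrable and, for every x with g(x) ≠ h(x), g(x) ≥ ρ/2 and h(x) > 0. Then ∫_{{x : g(x) ≠ h(x)}} ( g(x) − h(x) − h(x) · log(g(x)/h(x)) ) dx ≤ (2/ρ) ∫ (g(x) − h(x))² dx. -/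
open MeasureTheory

theorem sub_sub_mul_log_div_nonneg {a b : ℝ} (ha : 0 < a) (hb : 0 < b) :
    0 ≤ a - b - b * Real.log (a / b) := by
  have hlog := mul_le_mul_of_nonneg_left (Real.log_le_sub_one_of_pos (div_pos ha hb)) hb.le
  have heq : b * (a / b - 1) = a - b := by field_simp
  linarith

theorem sub_sub_mul_log_div_le {a b : ℝ} (ha : 0 < a) (hb : 0 < b) :
    a - b - b * Real.log (a / b) ≤ (a - b) ^ 2 / a := by
  have hlog := mul_le_mul_of_nonneg_left (Real.one_sub_inv_le_log_of_pos (div_pos ha hb)) hb.le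
  have heq : a - b - b * (1 - (a / b)⁻¹) = (a - b) ^ 2 / a := by
    field_simp
  linarith

/-- Inequality (4.13) of the paper: if `(g - h)²` is integrable and, on the set where `g` and
`h` differ, `g ≥ ρ/2` and `h > 0`, then the Kullback–Leibler-type integral
`∫_{g ≠ h} (g - h - h log(g/h))` is at most `(2/ρ) ∫ (g - h)²`. -/
theorem kl_integral_le_L2 (ρ : ℝ) (hρ : 0 < ρ) (g h : ℝ → ℝ)
    (hg : Measurable g) (hh : Measurable h)
    (hint : Integrable (fun x => (g x - h x) ^ 2))
    (hge : ∀ x, g x ≠ h x → ρ / 2 ≤ g x)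
    (hhpos : ∀ x, g x ≠ h x → 0 < h x) :
    ∫ x in {x | g x ≠ h x}, (g x - h x - h x * Real.log (g x / h x))
      ≤ (2 / ρ) * ∫ x, (g x - h x) ^ 2 := by
  have hρ2 : 0 < ρ / 2 := half_pos hρ
  have hmeas : MeasurableSet {x | g x ≠ h x} := (measurableSet_eq_fun hg hh).compl
  have hint' : Integrable (fun x => (2 / ρ) * (g x - h x) ^ 2) := hint.const_mul _
  rw [← integral_const_mul]
  calc ∫ x in {x | g x ≠ h x}, (g x - h x - h x * Real.log (g x / h x))
      ≤ ∫ x in {x | g x ≠ h x}, (2 / ρ) * (g x - h x) ^ 2 := by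
        refine integral_mono_of_nonneg ?_ hint'.integrableOn ?_
        · filter_upwards [ae_restrict_mem hmeas] with x hx
          exact sub_sub_mul_log_div_nonneg (hρ2.trans_le (hge x hx)) (hhpos x hx)
        · filter_upwards [ae_restrict_mem hmeas] with x hx
          calc g x - h x - h x * Real.log (g x / h x)
              ≤ (g x - h x) ^ 2 / g x :=
                sub_sub_mul_log_div_le (hρ2.trans_le (hge x hx)) (hhpos x hx)
            _ ≤ (g x - h x) ^ 2 / (ρ / 2) :=
                div_le_div_of_nonneg_left (sq_nonneg _) hρ2 (hge x hx)
            _ = (2 / ρ) * (g x - h x) ^ 2 := by field_simp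
    _ ≤ ∫ x, (2 / ρ) * (g x - h x) ^ 2 :=
        setIntegral_le_integral hint' (Filter.Eventually.of_forall fun x => by positivity)
end
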